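/- arXiv:2605.05093 — 5 statements merged into one kernel-verified Lean document; each statement's English description precedes it below -/
import Mathlib

section
/- Let μ ∈ ℝ^p satisfy ‖μ_{N_i}‖₂ ≤ 2τ_i and ‖μ_{N_i}‖_∞ ≤ 2ξ for every i ∈ {1,…,p}. Then ⟨β, μ⟩ ≤ Ω(β) for every β ∈ ℝ^p; consequently the Fenchel conjugate of Ω vanishes at μ, i.e. sup_{β ∈ ℝ^p} ( ⟨β, μ⟩ − Ω(β) ) = 0. (This is the conjugate computation underlying Lemma 1: the conjugate of the doubly sparse latent group regularizer equals 0 on the set K^𝔾_p = {μ : ‖μ_{N_i}‖₂ ≤ 2τ_i and ‖μ_{N_i}‖_∞ ≤ 2ξ for all i}.) -/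
open scoped BigOperators

/-- Euclidean (ℓ₂) norm of a vector in ℝ^p. -/
noncomputable def l2 {p : ℕ} (v : Fin p → ℝ) : ℝ := Real.sqrt (∑ j, v j ^ 2)

/-- ℓ₁ norm of a vector in ℝ^p. -/
noncomputable def l1 {p : ℕ} (v : Fin p → ℝ) : ℝ := ∑ j, |v j|

/-- ℓ∞ norm of a vector in ℝ^p. -/
noncomputable def linf {p : ℕ} (v : Fin p → ℝ) : ℝ := ⨆ j, |v j|

/-- The vector agreeing with `v` on the coordinate set `s` and equal to 0 elsewhere. -/
def restr {p : ℕ} (s : Finset (Fin p)) (v : Fin p → ℝ) : Fin p → ℝ :=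
  fun j => if j ∈ s then v j else 0

/-- The doubly sparse latent group regularizer
`Ω(β) = inf { ∑ᵢ (τᵢ ‖V⁽ⁱ⁾‖₂ + ξ ‖V⁽ⁱ⁾‖₁) : supp V⁽ⁱ⁾ ⊆ Nᵢ, ∑ᵢ V⁽ⁱ⁾ = β }`. -/
noncomputable def OmegaReg {p : ℕ} (N : Fin p → Finset (Fin p)) (τ : Fin p → ℝ) (ξ : ℝ)
    (β : Fin p → ℝ) : ℝ :=
  sInf { r : ℝ | ∃ V : Fin p → Fin p → ℝ,
    (∀ i, ∀ j, j ∉ N i → V i j = 0) ∧ (∑ i, V i) = β ∧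
    r = ∑ i, (τ i * l2 (V i) + ξ * l1 (V i)) }

lemma l2_nonneg {p : ℕ} (v : Fin p → ℝ) : 0 ≤ l2 v := Real.sqrt_nonneg _

lemma l1_nonneg {p : ℕ} (v : Fin p → ℝ) : 0 ≤ l1 v :=
  Finset.sum_nonneg fun _ _ => abs_nonneg _

lemma abs_le_linf {p : ℕ} (v : Fin p → ℝ) (j : Fin p) : |v j| ≤ linf v :=
  le_ciSup (f := fun j => |v j|) (Set.finite_range _).bddAbove j

/-- Cauchy–Schwarz inequality. -/
lemma sum_mul_le_l2_mul_l2 {p : ℕ} (v w : Fin p → ℝ) : ∑ j, v j * w j ≤ l2 v * l2 w :=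
  Real.sum_mul_le_sqrt_mul_sqrt _ v w

/-- Hölder's inequality for the pair `ℓ₁`, `ℓ∞`. -/
lemma sum_mul_le_l1_mul_linf {p : ℕ} (v w : Fin p → ℝ) : ∑ j, v j * w j ≤ l1 v * linf w := by
  rw [l1, Finset.sum_mul]
  refine Finset.sum_le_sum fun j _ => (le_abs_self _).trans ?_
  rw [abs_mul]
  exact mul_le_mul_of_nonneg_left (abs_le_linf w j) (abs_nonneg _)

lemma sum_mul_restr {p : ℕ} (s : Finset (Fin p)) (v w : Fin p → ℝ)
    (hv : ∀ j, j ∉ s → v j = 0) : ∑ j, v j * restr s w j = ∑ j, v j * w j := by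
  refine Finset.sum_congr rfl fun j _ => ?_
  by_cases hj : j ∈ s
  · simp [restr, hj]
  · simp [hv j hj]

/-- A vector supported in `s` pairs with `w` to at most its sparse group penalty, as soon as
the dual norms of `w` restricted to `s` are at most twice the weights. -/
lemma sum_mul_le_of_restr_le {p : ℕ} (s : Finset (Fin p)) (v w : Fin p → ℝ) {t ξ : ℝ}
    (hv : ∀ j, j ∉ s → v j = 0) (h2 : l2 (restr s w) ≤ 2 * t)
    (hinf : linf (restr s w) ≤ 2 * ξ) : ∑ j, v j * w j ≤ t * l2 v + ξ * l1 v := by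
  rw [← sum_mul_restr s v w hv]
  have hcs := sum_mul_le_l2_mul_l2 v (restr s w)
  have hh := sum_mul_le_l1_mul_linf v (restr s w)
  have h2' := mul_le_mul_of_nonneg_left h2 (l2_nonneg v)
  have hinf' := mul_le_mul_of_nonneg_left hinf (l1_nonneg v)
  linarith

lemma sum_mul_le_OmegaReg {p : ℕ} (N : Fin p → Finset (Fin p)) (hN : ∀ i, i ∈ N i)
    (τ : Fin p → ℝ) (ξ : ℝ) (w : Fin p → ℝ) (h2 : ∀ i, l2 (restr (N i) w) ≤ 2 * τ i)
    (hinf : ∀ i, linf (restr (N i) w) ≤ 2 * ξ) (β : Fin p → ℝ) :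
    ∑ j, β j * w j ≤ OmegaReg N τ ξ β := by
  refine le_csInf ⟨_, fun i => Pi.single i (β i), ?_, Finset.univ_sum_single β, rfl⟩ ?_
  · intro i j hj
    exact Pi.single_eq_of_ne (ne_of_mem_of_not_mem (hN i) hj).symm _
  · rintro r ⟨V, hV, rfl, rfl⟩
    simp only [Finset.sum_apply, Finset.sum_mul]
    rw [Finset.sum_comm]
    exact Finset.sum_le_sum fun i _ => sum_mul_le_of_restr_le (N i) (V i) w (hV i) (h2 i) (hinf i)

lemma OmegaReg_zero_le {p : ℕ} (N : Fin p → Finset (Fin p)) {τ : Fin p → ℝ}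
    (hτ : ∀ i, 0 ≤ τ i) {ξ : ℝ} (hξ : 0 ≤ ξ) : OmegaReg N τ ξ 0 ≤ 0 := by
  refine csInf_le ⟨0, ?_⟩ ⟨0, by simp, by simp, by simp [l2, l1]⟩
  rintro r ⟨V, -, -, rfl⟩
  exact Finset.sum_nonneg fun i _ =>
    add_nonneg (mul_nonneg (hτ i) (l2_nonneg _)) (mul_nonneg hξ (l1_nonneg _))

/-- if `‖μ_{Nᵢ}‖₂ ≤ 2τᵢ` and `‖μ_{Nᵢ}‖∞ ≤ 2ξ` for all `i`, then
`⟨β, μ⟩ ≤ Ω(β)` for all `β`, and the Fenchel conjugate of `Ω` vanishes at `μ`. -/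
theorem stmt0 {p : ℕ} (N : Fin p → Finset (Fin p)) (hN : ∀ i, i ∈ N i)
    (τ : Fin p → ℝ) (hτ : ∀ i, 0 < τ i) (ξ : ℝ) (hξ : 0 < ξ)
    (μv : Fin p → ℝ)
    (hμ2 : ∀ i, l2 (restr (N i) μv) ≤ 2 * τ i)
    (hμinf : ∀ i, linf (restr (N i) μv) ≤ 2 * ξ) :
    (∀ β : Fin p → ℝ, (∑ j, β j * μv j) ≤ OmegaReg N τ ξ β) ∧
    sSup { r : ℝ | ∃ β : Fin p → ℝ, r = (∑ j, β j * μv j) - OmegaReg N τ ξ β } = 0 := by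
  have hle := sum_mul_le_OmegaReg N hN τ ξ μv hμ2 hμinf
  refine ⟨hle, IsGreatest.csSup_eq ⟨⟨0, ?_⟩, ?_⟩⟩
  · have h0 := hle 0
    simp only [Pi.zero_apply, zero_mul, Finset.sum_const_zero] at h0 ⊢
    linarith [OmegaReg_zero_le N (fun i => (hτ i).le) hξ.le]
  · rintro r ⟨β, rfl⟩
    exact sub_nonpos.mpr (hle β)
end

section
/- (Lemma 2, active-group reduction.) Let G = {1,…,p} be the full collection of group indices and let x ∈ ℝ^p. Define the set of active groups Ĝ = { i ∈ G : ‖x_{N_i}‖₂ ≥ τ*_i or ‖x_{N_i}‖_∞ ≥ ξ*_i }. Then the Euclidean projection of x onto K^G coincides with the Euclidean projection of x onto K^Ĝ: P_{K^G}(x) = P_{K^Ĝ}(x). -/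
open scoped BigOperators

/-- `K^S = { β : ‖β_{Nᵢ}‖₂ ≤ τ*ᵢ and ‖β_{Nᵢ}‖∞ ≤ ξ*ᵢ for every i ∈ S }`. -/
def Kset {p : ℕ} (N : Fin p → Finset (Fin p)) (τs ξs : Fin p → ℝ) (S : Set (Fin p)) :
    Set (Fin p → ℝ) :=
  { β | ∀ i ∈ S, l2 (restr (N i) β) ≤ τs i ∧ linf (restr (N i) β) ≤ ξs i }

/-- `y` is a Euclidean projection of `x` onto `K`. -/
def IsProjOn {p : ℕ} (K : Set (Fin p → ℝ)) (x y : Fin p → ℝ) : Prop :=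
  y ∈ K ∧ ∀ z ∈ K, l2 (x - y) ≤ l2 (x - z)

theorem l2_le_l2_iff {p : ℕ} {u v : Fin p → ℝ} :
    l2 u ≤ l2 v ↔ ∑ j, u j ^ 2 ≤ ∑ j, v j ^ 2 :=
  Real.sqrt_le_sqrt_iff (Finset.sum_nonneg fun _ _ => sq_nonneg _)

theorem l2_restr_le_iff {p : ℕ} {s : Finset (Fin p)} {v : Fin p → ℝ} {t : ℝ} (ht : 0 ≤ t) :
    l2 (restr s v) ≤ t ↔ ∑ j ∈ s, v j ^ 2 ≤ t ^ 2 := by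
  have h : ∑ j, restr s v j ^ 2 = ∑ j ∈ s, v j ^ 2 := by
    simp [restr, ite_pow]
  rw [l2, h, Real.sqrt_le_left ht]

theorem linf_restr_le_iff {p : ℕ} {s : Finset (Fin p)} {v : Fin p → ℝ} {t : ℝ} (ht : 0 ≤ t) :
    linf (restr s v) ≤ t ↔ ∀ j ∈ s, |v j| ≤ t := by
  constructor
  · intro h j hj
    have hle : |restr s v j| ≤ linf (restr s v) :=
      le_ciSup (f := fun j => |restr s v j|) (Set.finite_range _).bddAbove j
    simpa [restr, hj] using hle.trans h
  · intro h
    refine Real.iSup_le (fun j => ?_) ht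
    by_cases hj : j ∈ s
    · simpa [restr, hj] using h j hj
    · simpa [restr, hj] using ht

theorem mem_Kset_iff {p : ℕ} {N : Fin p → Finset (Fin p)} {τs ξs : Fin p → ℝ}
    (hτ : ∀ i, 0 < τs i) (hξ : ∀ i, 0 < ξs i) {S : Set (Fin p)} {β : Fin p → ℝ} :
    β ∈ Kset N τs ξs S ↔
      ∀ i ∈ S, ∑ j ∈ N i, β j ^ 2 ≤ τs i ^ 2 ∧ ∀ j ∈ N i, |β j| ≤ ξs i := by
  simp only [Kset, Set.mem_ofPred_eq, l2_restr_le_iff (hτ _).le, linf_restr_le_iff (hξ _).le]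

/-- Projecting onto a solid set does not increase the absolute value of any coordinate. -/
theorem IsProjOn.abs_le {p : ℕ} {K : Set (Fin p → ℝ)} {x z : Fin p → ℝ}
    (hK : ∀ v ∈ K, ∀ w : Fin p → ℝ, (∀ j, |w j| ≤ |v j|) → w ∈ K)
    (hz : IsProjOn K x z) (j : Fin p) : |z j| ≤ |x j| := by
  by_contra! hj
  let w : Fin p → ℝ := fun k => if |x k| < |z k| then x k else z k
  have hw : w ∈ K := by
    refine hK z hz.1 w fun k => ?_
    by_cases h : |x k| < |z k|
    · simpa [w, h] using h.le
    · simp [w, h]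
  have hlt : ∑ k, (x - w) k ^ 2 < ∑ k, (x - z) k ^ 2 := by
    refine Finset.sum_lt_sum (fun k _ => ?_) ⟨j, Finset.mem_univ j, ?_⟩
    · by_cases h : |x k| < |z k|
      · simpa [w, h] using sq_nonneg (x k - z k)
      · simp [w, h]
    · have hne : x j - z j ≠ 0 := fun h => by
        rw [sub_eq_zero.mp h] at hj
        exact lt_irrefl _ hj
      have hpos : 0 < (x j - z j) ^ 2 := by positivity
      simpa [w, hj] using hpos
  exact absurd (l2_le_l2_iff.mp (hz.2 w hw)) hlt.not_ge

theorem IsProjOn.eq_of_midpoint_mem {p : ℕ} {K : Set (Fin p → ℝ)} {x y z : Fin p → ℝ}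
    (hy : IsProjOn K x y) (hz : IsProjOn K x z)
    (hm : (fun j => (y j + z j) / 2) ∈ K) : y = z := by
  have h₁ := l2_le_l2_iff.mp (hy.2 _ hm)
  have h₂ := l2_le_l2_iff.mp (hz.2 _ hm)
  have hid : ∑ j, (x - fun j => (y j + z j) / 2) j ^ 2 =
      (∑ j, (x - y) j ^ 2) / 2 + (∑ j, (x - z) j ^ 2) / 2 - (∑ j, (y j - z j) ^ 2) / 4 := by
    simp only [Finset.sum_div, ← Finset.sum_add_distrib, ← Finset.sum_sub_distrib, Pi.sub_apply]
    exact Finset.sum_congr rfl fun j _ => by ring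
  have hnonneg : ∀ j ∈ Finset.univ, 0 ≤ (y j - z j) ^ 2 := fun _ _ => sq_nonneg _
  have hzero : ∑ j, (y j - z j) ^ 2 = 0 :=
    le_antisymm (by linarith) (Finset.sum_nonneg hnonneg)
  funext j
  have hj := (Finset.sum_eq_zero_iff_of_nonneg hnonneg).mp hzero j (Finset.mem_univ j)
  exact sub_eq_zero.mp (pow_eq_zero_iff two_ne_zero |>.mp hj)

/-- Lemma 2, active-group reduction: the projection of `x` onto `K^G`
(`G` the full collection of groups) coincides with the projection of `x` onto `K^Ĝ`,
where `Ĝ = { i : ‖x_{Nᵢ}‖₂ ≥ τ*ᵢ or ‖x_{Nᵢ}‖∞ ≥ ξ*ᵢ }`. -/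
theorem stmt1 {p : ℕ} (N : Fin p → Finset (Fin p)) (τs ξs : Fin p → ℝ)
    (hτ : ∀ i, 0 < τs i) (hξ : ∀ i, 0 < ξs i) (x : Fin p → ℝ)
    (y z : Fin p → ℝ)
    (hy : IsProjOn (Kset N τs ξs Set.univ) x y)
    (hz : IsProjOn (Kset N τs ξs
        { i | τs i ≤ l2 (restr (N i) x) ∨ ξs i ≤ linf (restr (N i) x) }) x z) :
    y = z := by
  have hle : ∀ j, |z j| ≤ |x j| := hz.abs_le fun v hv w hw => by
    rw [mem_Kset_iff hτ hξ] at hv ⊢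
    exact fun i hi => ⟨(Finset.sum_le_sum fun j _ => sq_le_sq.mpr (hw j)).trans (hv i hi).1,
      fun j hj => (hw j).trans ((hv i hi).2 j hj)⟩
  have hzK : z ∈ Kset N τs ξs Set.univ := by
    have hzA := (mem_Kset_iff hτ hξ).mp hz.1
    rw [mem_Kset_iff hτ hξ]
    intro i _
    by_cases hi : τs i ≤ l2 (restr (N i) x) ∨ ξs i ≤ linf (restr (N i) x)
    · exact hzA i hi
    · push Not at hi
      have h₂ := (l2_restr_le_iff (hτ i).le).mp hi.1.le
      have h₃ := (linf_restr_le_iff (hξ i).le).mp hi.2.le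
      exact ⟨(Finset.sum_le_sum fun j _ => sq_le_sq.mpr (hle j)).trans h₂,
        fun j hj => (hle j).trans (h₃ j hj)⟩
  refine hy.eq_of_midpoint_mem ⟨hzK, fun v hv => hz.2 v fun i _ => hv i (Set.mem_univ i)⟩ ?_
  have hyK := (mem_Kset_iff hτ hξ).mp hy.1
  rw [mem_Kset_iff hτ hξ] at hzK ⊢
  refine fun i hi => ⟨?_, fun j hj => ?_⟩
  · calc ∑ j ∈ N i, ((y j + z j) / 2) ^ 2
        ≤ ∑ j ∈ N i, (y j ^ 2 / 2 + z j ^ 2 / 2) :=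
          Finset.sum_le_sum fun j _ => by nlinarith [sq_nonneg (y j - z j)]
      _ = (∑ j ∈ N i, y j ^ 2) / 2 + (∑ j ∈ N i, z j ^ 2) / 2 := by
          rw [Finset.sum_add_distrib, Finset.sum_div, Finset.sum_div]
      _ ≤ τs i ^ 2 := by linarith [(hyK i hi).1, (hzK i hi).1]
  · have h₂ := abs_le.mp ((hyK i hi).2 j hj)
    have h₃ := abs_le.mp ((hzK i hi).2 j hj)
    exact abs_le.mpr ⟨by linarith, by linarith⟩
end

section
/- (Coordinatewise non-expansiveness of the projection, used in the proof of Lemma 2.) For every subset S ⊆ {1,…,p} of group indices and every x ∈ ℝ^p, the Euclidean projection of x onto K^S is coordinatewise non-expansive with respect to zero: for every coordinate j ∈ {1,…,p}, |(P_{K^S}(x))_j| ≤ |x_j|. -/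
open scoped BigOperators

theorem l2_restr_le_of_abs_le {p : ℕ} (s : Finset (Fin p)) {v w : Fin p → ℝ}
    (h : ∀ k, |v k| ≤ |w k|) : l2 (restr s v) ≤ l2 (restr s w) := by
  refine Real.sqrt_le_sqrt (Finset.sum_le_sum fun k _ => ?_)
  unfold restr
  split_ifs
  · exact sq_le_sq.2 (h k)
  · exact le_rfl

theorem linf_restr_le_of_abs_le {p : ℕ} (s : Finset (Fin p)) {v w : Fin p → ℝ}
    (h : ∀ k, |v k| ≤ |w k|) : linf (restr s v) ≤ linf (restr s w) := by
  refine ciSup_mono (Set.finite_range _).bddAbove fun k => ?_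
  unfold restr
  split_ifs
  · exact h k
  · exact le_rfl

/-- `K^S` is solid: it is closed under decreasing absolute values of coordinates. -/
theorem mem_Kset_of_abs_le {p : ℕ} {N : Fin p → Finset (Fin p)} {τs ξs : Fin p → ℝ}
    {S : Set (Fin p)} {v w : Fin p → ℝ} (hw : w ∈ Kset N τs ξs S)
    (h : ∀ k, |v k| ≤ |w k|) : v ∈ Kset N τs ξs S := fun i hi =>
  ⟨(l2_restr_le_of_abs_le (N i) h).trans (hw i hi).1,
    (linf_restr_le_of_abs_le (N i) h).trans (hw i hi).2⟩

/-- coordinatewise non-expansiveness of the projection: for every set `S`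
of group indices and every `x`, any Euclidean projection `y` of `x` onto `K^S`
satisfies `|y j| ≤ |x j|` for every coordinate `j`. -/
theorem stmt2 {p : ℕ} (N : Fin p → Finset (Fin p)) (τs ξs : Fin p → ℝ)
    (hτ : ∀ i, 0 < τs i) (hξ : ∀ i, 0 < ξs i)
    (S : Set (Fin p)) (x y : Fin p → ℝ)
    (hy : IsProjOn (Kset N τs ξs S) x y) :
    ∀ j : Fin p, |y j| ≤ |x j| := by
  intro j
  by_contra! hj
  have hz : Function.update y j (x j) ∈ Kset N τs ξs S := by
    refine mem_Kset_of_abs_le hy.1 fun k => ?_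
    rcases eq_or_ne k j with rfl | hk
    · simpa using hj.le
    · simp [hk]
  refine (hy.2 _ hz).not_gt (Real.sqrt_lt_sqrt (Finset.sum_nonneg fun k _ => sq_nonneg _) ?_)
  refine Finset.sum_lt_sum (fun k _ => ?_) ⟨j, Finset.mem_univ j, ?_⟩
  · rcases eq_or_ne k j with rfl | hk
    · simpa using sq_nonneg (x k - y k)
    · simp [hk]
  · have hne : x j - y j ≠ 0 := fun h => hj.ne (by rw [sub_eq_zero.1 h])
    simpa using sq_pos_of_ne_zero hne
end

section
/- (Lemma: decomposability of the SGLIG regularizer.) Suppose the group indices are partitioned as {1,…,p} = S ∪ Sᶜ in such a way that the coordinate sets A = ∪_{i∈S} N_i and B = ∪_{i∈Sᶜ} N_i are disjoint. Then for every θ ∈ ℝ^p with supp(θ) ⊆ A and every γ ∈ ℝ^p with supp(γ) ⊆ B, the SGLIG regularizer satisfies R(θ + γ) = R(θ) + R(γ). In particular R is decomposable with respect to the subspace pair (M_{S_G}, M̄_{S_G}^⊥), where M_{S_G} = {θ ∈ ℝ^p : θ_j = 0 for j ∉ A} and M̄_{S_G}^⊥ = {γ ∈ ℝ^p : γ_j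 = 0 for j ∉ B}. -/
open scoped BigOperators

/-- The SGLIG regularizer
`R(β) = inf { ∑ᵢ (α τᵢ ‖V⁽ⁱ⁾‖₂ + (1−α) √dᵢ ‖V⁽ⁱ⁾‖₁) : supp V⁽ⁱ⁾ ⊆ Nᵢ, ∑ᵢ V⁽ⁱ⁾ = β }`,
where `dᵢ = |Nᵢ|`. -/
noncomputable def Rreg {p : ℕ} (N : Fin p → Finset (Fin p)) (τ : Fin p → ℝ) (α : ℝ)
    (β : Fin p → ℝ) : ℝ :=
  sInf { r : ℝ | ∃ V : Fin p → Fin p → ℝ,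
    (∀ i, ∀ j, j ∉ N i → V i j = 0) ∧ (∑ i, V i) = β ∧
    r = ∑ i, (α * τ i * l2 (V i) + (1 - α) * Real.sqrt ((N i).card) * l1 (V i)) }

/-- The penalty paid by the latent vector attached to group `i`. -/
noncomputable def groupCost {p : ℕ} (N : Fin p → Finset (Fin p)) (τ : Fin p → ℝ) (α : ℝ)
    (i : Fin p) (v : Fin p → ℝ) : ℝ :=
  α * τ i * l2 v + (1 - α) * Real.sqrt ((N i).card) * l1 v

/-- The values of the objective over all latent decompositions of `β`. -/
def latentCosts {p : ℕ} (N : Fin p → Finset (Fin p)) (τ : Fin p → ℝ) (α : ℝ)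
    (β : Fin p → ℝ) : Set ℝ :=
  { r : ℝ | ∃ V : Fin p → Fin p → ℝ,
    (∀ i, ∀ j, j ∉ N i → V i j = 0) ∧ (∑ i, V i) = β ∧ r = ∑ i, groupCost N τ α i (V i) }

section

variable {p : ℕ} {N : Fin p → Finset (Fin p)} {τ : Fin p → ℝ} {α : ℝ}

theorem Rreg_eq_sInf_latentCosts (β : Fin p → ℝ) :
    Rreg N τ α β = sInf (latentCosts N τ α β) := rfl

theorem groupCost_nonneg (hτ : ∀ i, 0 < τ i) (hα : 0 ≤ α ∧ α ≤ 1) (i : Fin p)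
    (v : Fin p → ℝ) : 0 ≤ groupCost N τ α i v := by
  have h₂ : 0 ≤ l2 v := Real.sqrt_nonneg _
  have h₁ : 0 ≤ l1 v := Finset.sum_nonneg fun j _ => abs_nonneg (v j)
  have hα' : 0 ≤ 1 - α := sub_nonneg.2 hα.2
  have hi := (hτ i).le
  have := hα.1
  unfold groupCost
  positivity

theorem groupCost_zero (i : Fin p) : groupCost N τ α i 0 = 0 := by
  simp [groupCost, l1, l2]

theorem latentCosts_nonempty (hN : ∀ i, i ∈ N i) (β : Fin p → ℝ) :
    (latentCosts N τ α β).Nonempty :=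
  ⟨_, fun i => Pi.single i (β i),
    fun i _ hj => Pi.single_eq_of_ne (ne_of_mem_of_not_mem (hN i) hj).symm _,
    Finset.univ_sum_single β, rfl⟩

theorem latentCosts_bddBelow (hτ : ∀ i, 0 < τ i) (hα : 0 ≤ α ∧ α ≤ 1) (β : Fin p → ℝ) :
    BddBelow (latentCosts N τ α β) := by
  refine ⟨0, ?_⟩
  rintro _ ⟨V, -, -, rfl⟩
  exact Finset.sum_nonneg fun i _ => groupCost_nonneg hτ hα i _

theorem indicator_apply_eq_zero {V : Fin p → Fin p → ℝ} (hV : ∀ i, ∀ j, j ∉ N i → V i j = 0)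
    (S : Set (Fin p)) (i j : Fin p) (hj : j ∉ N i) : S.indicator V i j = 0 := by
  by_cases hi : i ∈ S <;> simp [hi, hV i j hj]

/-- If the coordinates covered by `S` and `Sᶜ` are disjoint, keeping only the latent vectors
indexed by `S` recovers the part of `β` on the coordinates covered by `S`. -/
theorem sum_indicator_latent {V : Fin p → Fin p → ℝ} {β : Fin p → ℝ}
    (hV : ∀ i, ∀ j, j ∉ N i → V i j = 0) (hsum : ∑ i, V i = β) {S : Set (Fin p)}
    (hdisj : Disjoint (⋃ i ∈ S, (N i : Set (Fin p))) (⋃ i ∈ Sᶜ, (N i : Set (Fin p)))) :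
    ∑ i, S.indicator V i = (⋃ i ∈ S, (N i : Set (Fin p))).indicator β := by
  funext j
  rw [Finset.sum_apply]
  by_cases hj : j ∈ ⋃ i ∈ S, (N i : Set (Fin p))
  · rw [Set.indicator_of_mem hj, ← hsum, Finset.sum_apply]
    refine Finset.sum_congr rfl fun i _ => ?_
    by_cases hi : i ∈ S
    · rw [Set.indicator_of_mem hi]
    · rw [Set.indicator_of_notMem hi, Pi.zero_apply, hV i j]
      exact fun hji => Set.disjoint_left.1 hdisj hj (Set.mem_biUnion hi hji)
  · rw [Set.indicator_of_notMem hj]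
    refine Finset.sum_eq_zero fun i _ => ?_
    by_cases hi : i ∈ S
    · rw [Set.indicator_of_mem hi, hV i j fun hji => hj (Set.mem_biUnion hi hji)]
    · rw [Set.indicator_of_notMem hi, Pi.zero_apply]

theorem indicator_add_eq_left {A B : Set (Fin p)} (hdisj : Disjoint A B) {θ γ : Fin p → ℝ}
    (hθ : ∀ j, j ∉ A → θ j = 0) (hγ : ∀ j, j ∉ B → γ j = 0) : A.indicator (θ + γ) = θ := by
  funext j
  by_cases hj : j ∈ A
  · simp [hj, hγ j (Set.disjoint_left.1 hdisj hj)]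
  · simp [hj, hθ j hj]

end

/-- decomposability of the SGLIG regularizer: if the group indices are
partitioned as `S ∪ Sᶜ` so that the coordinate sets `A = ⋃_{i∈S} Nᵢ` and
`B = ⋃_{i∈Sᶜ} Nᵢ` are disjoint, then `R(θ + γ) = R(θ) + R(γ)` whenever
`supp θ ⊆ A` and `supp γ ⊆ B`. -/
theorem stmt6 {p : ℕ} (N : Fin p → Finset (Fin p)) (hN : ∀ i, i ∈ N i)
    (τ : Fin p → ℝ) (hτ : ∀ i, 0 < τ i)
    (α : ℝ) (hα : 0 ≤ α ∧ α ≤ 1)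
    (S : Set (Fin p))
    (hdisj : Disjoint (⋃ i ∈ S, (N i : Set (Fin p))) (⋃ i ∈ Sᶜ, (N i : Set (Fin p))))
    (θ γ : Fin p → ℝ)
    (hθ : ∀ j, j ∉ (⋃ i ∈ S, (N i : Set (Fin p))) → θ j = 0)
    (hγ : ∀ j, j ∉ (⋃ i ∈ Sᶜ, (N i : Set (Fin p))) → γ j = 0) :
    Rreg N τ α (θ + γ) = Rreg N τ α θ + Rreg N τ α γ := by
  have hdisj' : Disjoint (⋃ i ∈ Sᶜ, (N i : Set (Fin p))) (⋃ i ∈ Sᶜᶜ, (N i : Set (Fin p))) := by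
    rw [compl_compl]
    exact hdisj.symm
  have hθ' := Set.indicator_eq_self.2 (Function.support_subset_iff'.2 hθ)
  have hγ' := Set.indicator_eq_self.2 (Function.support_subset_iff'.2 hγ)
  simp only [Rreg_eq_sInf_latentCosts]
  apply le_antisymm
  · open scoped Pointwise in
    rw [← csInf_add (latentCosts_nonempty hN θ) (latentCosts_bddBelow hτ hα θ)
      (latentCosts_nonempty hN γ) (latentCosts_bddBelow hτ hα γ)]
    refine le_csInf ((latentCosts_nonempty hN θ).add (latentCosts_nonempty hN γ)) ?_
    rintro _ ⟨_, ⟨V, hV, hVθ, rfl⟩, _, ⟨W, hW, hWγ, rfl⟩, rfl⟩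
    refine (csInf_le (latentCosts_bddBelow hτ hα _)
      ⟨fun i => S.indicator V i + Sᶜ.indicator W i, fun i j hj => ?_, ?_, rfl⟩).trans ?_
    · beta_reduce
      rw [Pi.add_apply, indicator_apply_eq_zero hV S i j hj,
        indicator_apply_eq_zero hW Sᶜ i j hj, add_zero]
    · rw [Finset.sum_add_distrib, sum_indicator_latent hV hVθ hdisj,
        sum_indicator_latent hW hWγ hdisj', hθ', hγ']
    · simp only [← Finset.sum_add_distrib]
      refine Finset.sum_le_sum fun i _ => ?_
      have hVi := groupCost_nonneg (N := N) hτ hα i (V i)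
      have hWi := groupCost_nonneg (N := N) hτ hα i (W i)
      by_cases hi : i ∈ S <;> simpa [hi]
  · refine le_csInf (latentCosts_nonempty hN _) ?_
    rintro _ ⟨U, hU, hUsum, rfl⟩
    have hUθ : ∑ i, S.indicator U i = θ := by
      rw [sum_indicator_latent hU hUsum hdisj, indicator_add_eq_left hdisj hθ hγ]
    have hUγ : ∑ i, Sᶜ.indicator U i = γ := by
      rw [sum_indicator_latent hU hUsum hdisj', add_comm,
        indicator_add_eq_left hdisj.symm hγ hθ]
    refine (add_le_add
      (csInf_le (latentCosts_bddBelow hτ hα _)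
        ⟨S.indicator U, indicator_apply_eq_zero hU S, hUθ, rfl⟩)
      (csInf_le (latentCosts_bddBelow hτ hα _)
        ⟨Sᶜ.indicator U, indicator_apply_eq_zero hU Sᶜ, hUγ, rfl⟩)).trans_eq ?_
    rw [← Finset.sum_add_distrib]
    refine Finset.sum_congr rfl fun i _ => ?_
    by_cases hi : i ∈ S <;> simp [hi, groupCost_zero]
end

section
/- (Subspace compatibility bound for the SGLIG regularizer.) Let A ⊆ {1,…,p} be a set of group indices with |A| = a, and suppose β ∈ ℝ^p admits a decomposition β = ∑_{i∈A} V^{(i)} where supp(V^{(i)}) ⊆ N_i for each i ∈ A and the supports of the V^{(i)} are pairwise disjoint. Let τ_max = max_{1≤i≤p} τ_i and d_max = max_{1≤i≤p} d_i. Then R(β) ≤ ( α τ_max + (1−α) d_max ) · √a · ‖β‖₂. (This bounds the subspace compatibility constant Ψ(M) = sup_{u∈M, u≠0} R(u)/‖u‖₂ of the SGLIG regularizer over the model subspace spanned by the a active groups.) -/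
open scoped BigOperators

@[simp] lemma l2_zero {p : ℕ} : l2 (0 : Fin p → ℝ) = 0 := by simp [l2]

@[simp] lemma l1_zero {p : ℕ} : l1 (0 : Fin p → ℝ) = 0 := by simp [l1]

lemma l2_sq {p : ℕ} (v : Fin p → ℝ) : l2 v ^ 2 = ∑ j, v j ^ 2 :=
  Real.sq_sqrt (Finset.sum_nonneg fun _ _ => sq_nonneg _)

/-- A vector supported on `S` satisfies `‖v‖₁ ≤ √|S| ‖v‖₂`. -/
lemma l1_le_sqrt_card_mul_l2 {p : ℕ} (S : Finset (Fin p)) (v : Fin p → ℝ)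
    (hv : ∀ j, j ∉ S → v j = 0) : l1 v ≤ Real.sqrt S.card * l2 v := by
  have hl1 : l1 v = ∑ j ∈ S, |v j| :=
    (Finset.sum_subset S.subset_univ fun j _ hj => by simp [hv j hj]).symm
  have hl2 : ∑ j, v j ^ 2 = ∑ j ∈ S, v j ^ 2 :=
    (Finset.sum_subset S.subset_univ fun j _ hj => by simp [hv j hj]).symm
  rw [hl1, l2, ← Real.sqrt_mul (Nat.cast_nonneg _), hl2]
  refine Real.le_sqrt_of_sq_le ?_
  simpa only [sq_abs] using sq_sum_le_card_mul_sum_sq (s := S) (f := fun j => |v j|)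

/-- Pythagoras for vectors with pairwise disjoint supports. -/
lemma l2_sum_sq_of_disjoint_support {p : ℕ} {ι : Type*} (A : Finset ι) (V : ι → Fin p → ℝ)
    (hV : (A : Set ι).Pairwise fun i i' => ∀ j, V i j = 0 ∨ V i' j = 0) :
    l2 (∑ i ∈ A, V i) ^ 2 = ∑ i ∈ A, l2 (V i) ^ 2 := by
  simp only [l2_sq]
  rw [Finset.sum_comm]
  refine Finset.sum_congr rfl fun j _ => ?_
  rw [Finset.sum_apply, sq, Finset.sum_mul_sum]
  refine Finset.sum_congr rfl fun i hi => ?_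
  rw [Finset.sum_eq_single_of_mem i hi, sq]
  intro k hk hki
  exact mul_eq_zero.mpr (hV hi hk hki.symm j)

lemma sum_l2_le_of_disjoint_support {p : ℕ} {ι : Type*} (A : Finset ι) (V : ι → Fin p → ℝ)
    (hV : (A : Set ι).Pairwise fun i i' => ∀ j, V i j = 0 ∨ V i' j = 0) :
    ∑ i ∈ A, l2 (V i) ≤ Real.sqrt A.card * l2 (∑ i ∈ A, V i) := by
  rw [← Real.sqrt_sq (l2_nonneg (∑ i ∈ A, V i)), ← Real.sqrt_mul (Nat.cast_nonneg _),
    l2_sum_sq_of_disjoint_support A V hV]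
  exact Real.le_sqrt_of_sq_le sq_sum_le_card_mul_sum_sq

/-- Any admissible decomposition over a subset `A` of the groups bounds the regularizer. -/
lemma Rreg_le_of_decomposition {p : ℕ} (N : Fin p → Finset (Fin p)) (τ : Fin p → ℝ)
    (hτ : ∀ i, 0 ≤ τ i) {α : ℝ} (hα : 0 ≤ α ∧ α ≤ 1) (A : Finset (Fin p))
    (V : Fin p → Fin p → ℝ) (hV : ∀ i ∈ A, ∀ j, j ∉ N i → V i j = 0) :
    Rreg N τ α (∑ i ∈ A, V i) ≤
      ∑ i ∈ A, (α * τ i * l2 (V i) + (1 - α) * Real.sqrt ((N i).card) * l1 (V i)) := by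
  refine csInf_le ⟨0, ?_⟩ ⟨fun i => if i ∈ A then V i else 0, ?_, ?_, ?_⟩
  · rintro r ⟨W, -, -, rfl⟩
    refine Finset.sum_nonneg fun i _ => add_nonneg ?_ ?_
    · exact mul_nonneg (mul_nonneg hα.1 (hτ i)) (l2_nonneg _)
    · exact mul_nonneg (mul_nonneg (sub_nonneg.mpr hα.2) (Real.sqrt_nonneg _)) (l1_nonneg _)
  · intro i j hj
    by_cases hi : i ∈ A
    · simpa [hi] using hV i hi j hj
    · simp [hi]
  · simp
  · rw [← Finset.sum_subset A.subset_univ]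
    · exact Finset.sum_congr rfl fun i hi => by simp [hi]
    · intro i _ hi
      simp [hi]

/-- subspace compatibility bound: if `β = ∑_{i∈A} V⁽ⁱ⁾` with
`supp V⁽ⁱ⁾ ⊆ Nᵢ` and pairwise disjoint supports, `|A| = a`, then
`R(β) ≤ (α τ_max + (1−α) d_max) √a ‖β‖₂`. -/
theorem stmt7 {p : ℕ} (N : Fin p → Finset (Fin p)) (hN : ∀ i, i ∈ N i)
    (τ : Fin p → ℝ) (hτ : ∀ i, 0 < τ i)
    (α : ℝ) (hα : 0 ≤ α ∧ α ≤ 1)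
    (τmax : ℝ) (hτmax : IsGreatest (Set.range τ) τmax)
    (dmax : ℕ) (hdmax : IsGreatest (Set.range fun i => (N i).card) dmax)
    (A : Finset (Fin p)) (a : ℕ) (ha : A.card = a)
    (V : Fin p → Fin p → ℝ)
    (hVsupp : ∀ i ∈ A, ∀ j, j ∉ N i → V i j = 0)
    (hVdisj : (A : Set (Fin p)).Pairwise fun i i' => ∀ j, V i j = 0 ∨ V i' j = 0)
    (β : Fin p → ℝ) (hβ : β = ∑ i ∈ A, V i) :
    Rreg N τ α β ≤ (α * τmax + (1 - α) * (dmax : ℝ)) * Real.sqrt a * l2 β := by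
  subst ha hβ
  refine (Rreg_le_of_decomposition N τ (fun i => (hτ i).le) hα A V hVsupp).trans ?_
  obtain ⟨i₀, hi₀⟩ := hτmax.1
  have hτmax0 : 0 ≤ τmax := hi₀ ▸ (hτ i₀).le
  have hα1 : 0 ≤ 1 - α := sub_nonneg.mpr hα.2
  have hC : 0 ≤ α * τmax + (1 - α) * (dmax : ℝ) :=
    add_nonneg (mul_nonneg hα.1 hτmax0) (mul_nonneg hα1 (Nat.cast_nonneg _))
  rw [mul_assoc]
  refine le_trans ?_ (mul_le_mul_of_nonneg_left (sum_l2_le_of_disjoint_support A V hVdisj) hC)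
  rw [Finset.mul_sum]
  refine Finset.sum_le_sum fun i hi => ?_
  have hτi : τ i ≤ τmax := hτmax.2 ⟨i, rfl⟩
  have hdi : ((N i).card : ℝ) ≤ dmax := Nat.cast_le.mpr (hdmax.2 ⟨i, rfl⟩)
  have hl2 := l2_nonneg (V i)
  have hl1 : Real.sqrt (N i).card * l1 (V i) ≤ dmax * l2 (V i) :=
    calc Real.sqrt (N i).card * l1 (V i)
        ≤ Real.sqrt (N i).card * (Real.sqrt (N i).card * l2 (V i)) :=
          mul_le_mul_of_nonneg_left (l1_le_sqrt_card_mul_l2 _ _ (hVsupp i hi))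
            (Real.sqrt_nonneg _)
      _ = (N i).card * l2 (V i) := by
          rw [← mul_assoc, Real.mul_self_sqrt (Nat.cast_nonneg _)]
      _ ≤ dmax * l2 (V i) := mul_le_mul_of_nonneg_right hdi hl2
  rw [add_mul, mul_assoc (1 - α), mul_assoc (1 - α)]
  exact add_le_add
    (mul_le_mul_of_nonneg_right (mul_le_mul_of_nonneg_left hτi hα.1) hl2)
    (mul_le_mul_of_nonneg_left hl1 hα1)
end
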